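/- (Lemma 2.) Let n be a highly composite number whose greatest prime divisor is p, with p ∣ n and p² ∤ n, and let n₁ be the smallest highly composite number greater than n. Then for every prime q with q > p, if the integer n·q/p lies in the interval [n, n₁), then n·q/p is a largely composite number. -/

import Mathlib

/-- `n` is a highly composite number: `d(m) < d(n)` for all positive `m < n`. -/
def HighlyComposite (n : ℕ) : Prop :=
  0 < n ∧ ∀ m : ℕ, 0 < m → m < n → m.divisors.card < n.divisors.card

/-- `n` is a largely composite number: `d(m) ≤ d(n)` for all positive `m < n`. -/
def LargelyComposite (n : ℕ) : Prop :=
  0 < n ∧ ∀ m : ℕ, 0 < m → m < n → m.divisors.card ≤ n.divisors.card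

/-- No positive integer below the next highly composite number has more divisors than `n`. -/
lemma HighlyComposite.card_divisors_le_of_lt_next {n n₁ : ℕ} (hn : HighlyComposite n)
    (hmin : ∀ m : ℕ, HighlyComposite m → n < m → n₁ ≤ m) {m : ℕ} (hm0 : 0 < m) (hm : m < n₁) :
    m.divisors.card ≤ n.divisors.card := by
  induction m using Nat.strong_induction_on with
  | _ m ih =>
    by_contra! hlt
    have hnm : n < m := by
      by_contra! hmn
      rcases hmn.lt_or_eq with h | rfl
      · exact lt_asymm hlt (hn.2 m hm0 h)
      · exact lt_irrefl _ hlt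
    have hmHC : HighlyComposite m :=
      ⟨hm0, fun k hk0 hkm => (ih k hkm hk0 (hkm.trans hm)).trans_lt hlt⟩
    exact absurd (hmin m hmHC hnm) hm.not_ge

/-- Multiplying by a prime that does not divide `k` doubles the number of divisors. -/
lemma Nat.Prime.card_divisors_mul {p k : ℕ} (hp : p.Prime) (hpk : ¬ p ∣ k) :
    (p * k).divisors.card = 2 * k.divisors.card := by
  rw [((hp.coprime_iff_not_dvd).2 hpk).card_divisors_mul, hp.divisors,
    Finset.card_pair hp.one_lt.ne]

/-- Lemma 2: if `n` is an HCN whose greatest prime divisor `p` satisfies `p ‖ n`,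
and `n₁` is the smallest HCN greater than `n`, then for every prime `q > p`
(with `q ∤ n`), if `n·q/p ∈ [n, n₁)` then `n·q/p` is largely composite. -/
theorem lcn_of_swap_in_interval (n p n₁ : ℕ)
    (hn : HighlyComposite n)
    (hp : p.Prime) (hpn : p ∣ n) (hp2 : ¬ p ^ 2 ∣ n)
    (hgreatest : ∀ r : ℕ, r.Prime → r ∣ n → r ≤ p)
    (hn₁ : HighlyComposite n₁) (hnn₁ : n < n₁)
    (hmin : ∀ m : ℕ, HighlyComposite m → n < m → n₁ ≤ m) :
    ∀ q : ℕ, q.Prime → p < q → ¬ q ∣ n →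
      n ≤ n * q / p → n * q / p < n₁ → LargelyComposite (n * q / p) := by
  intro q hq _ hqn _ hlt
  obtain ⟨k, rfl⟩ := hpn
  have hpk : ¬ p ∣ k := fun h => hp2 (by rw [sq]; exact mul_dvd_mul_left p h)
  have hqk : ¬ q ∣ k := fun h => hqn (h.mul_left p)
  have hswap : p * k * q / p = q * k := by
    rw [mul_assoc, Nat.mul_div_cancel_left _ hp.pos, mul_comm]
  rw [hswap] at hlt ⊢
  refine ⟨Nat.mul_pos hq.pos (Nat.pos_of_mul_pos_left hn.1), fun m hm0 hm => ?_⟩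
  rw [hq.card_divisors_mul hqk, ← hp.card_divisors_mul hpk]
  exact hn.card_divisors_le_of_lt_next hmin hm0 (hm.trans hlt)
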